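/- Let Γ₁ ⊆ Γ₂ ⊆ Γ₃ be Young diagrams with n, n+1 and n+2 boxes respectively, let (u₁,v₁) be the unique box of Γ₂ ∖ Γ₁ and (u₂,v₂) the unique box of Γ₃ ∖ Γ₂, and let I₁ = I_{Γ₁} ⊇ I₂ = I_{Γ₂} ⊇ I₃ = I_{Γ₃} be the corresponding monomial ideals of R = ℂ[x,y]. Then the Zariski tangent space T(I₁,I₂,I₃) of the three-step flag Hilbert scheme satisfies: dim_ℂ T(I₁,I₂,I₃) = 2n+4 if (u₂,v₂) = (u₁+1,v₁) or (u₂,v₂) = (u₁,v₁+1) (i.e. the second added box sits directly to the right of or directly above the first), and dim_ℂ T(I₁,I₂,I₃) = 2n+5 otherwise. -/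

import Mathlib

/-!
Statement 2: the dimension of the Zariski tangent space of Hilb^{n,n+1,n+2}(ℂ²) at a
torus fixed point (I_{Γ₁}, I_{Γ₂}, I_{Γ₃}) is 2n+4 if the second added box sits directly
to the right of or directly above the first added box, and 2n+5 otherwise.
-/

set_option synthInstance.maxHeartbeats 1000000
set_option maxHeartbeats 1000000

noncomputable section

open MvPolynomial

/-- `R = ℂ[x,y]`. -/
abbrev Rxy : Type := MvPolynomial (Fin 2) ℂ

/-- The monomial ideal of `R = ℂ[x,y]` associated with a Young diagram `Γ`: the ideal
generated by the monomials `x^u y^v` with `(u,v) ∉ Γ`. -/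
def monomialIdeal (Γ : YoungDiagram) : Ideal Rxy :=
  Ideal.span {m : Rxy | ∃ u v : ℕ, (u, v) ∉ Γ ∧ m = X 0 ^ u * X 1 ^ v}

/-- The canonical surjection `R⧸I → R⧸J` for nested ideals `I ≤ J`, as an `R`-linear map. -/
def quotFactor {I J : Ideal Rxy} (h : I ≤ J) : (Rxy ⧸ I) →ₗ[Rxy] Rxy ⧸ J :=
  Submodule.mapQ I J LinearMap.id h

/-- The Zariski tangent space `T(I₁,I₂,I₃)` of the three-step flag Hilbert scheme at a flag
`I₃ ≤ I₂ ≤ I₁`: the space of triples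
`(f,h,g) ∈ Hom_R(I₁,R/I₁) × Hom_R(I₂,R/I₂) × Hom_R(I₃,R/I₃)` with
`f(a) = π₂₁(h(a))` for all `a ∈ I₂` and `h(b) = π₃₂(g(b))` for all `b ∈ I₃`. -/
def flagTangent3 (I₁ I₂ I₃ : Ideal Rxy) (h21 : I₂ ≤ I₁) (h32 : I₃ ≤ I₂) :
    Submodule Rxy
      ((I₁ →ₗ[Rxy] Rxy ⧸ I₁) × (I₂ →ₗ[Rxy] Rxy ⧸ I₂) × (I₃ →ₗ[Rxy] Rxy ⧸ I₃)) :=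
  LinearMap.ker
      (((LinearMap.lcomp Rxy (Rxy ⧸ I₁) (Submodule.inclusion h21)).comp
          (LinearMap.fst Rxy (I₁ →ₗ[Rxy] Rxy ⧸ I₁)
            ((I₂ →ₗ[Rxy] Rxy ⧸ I₂) × (I₃ →ₗ[Rxy] Rxy ⧸ I₃))))
        - ((LinearMap.llcomp Rxy I₂ (Rxy ⧸ I₂) (Rxy ⧸ I₁) (quotFactor h21)).comp
          ((LinearMap.fst Rxy (I₂ →ₗ[Rxy] Rxy ⧸ I₂) (I₃ →ₗ[Rxy] Rxy ⧸ I₃)).comp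
            (LinearMap.snd Rxy (I₁ →ₗ[Rxy] Rxy ⧸ I₁)
              ((I₂ →ₗ[Rxy] Rxy ⧸ I₂) × (I₃ →ₗ[Rxy] Rxy ⧸ I₃))))))
    ⊓ LinearMap.ker
      (((LinearMap.lcomp Rxy (Rxy ⧸ I₂) (Submodule.inclusion h32)).comp
          ((LinearMap.fst Rxy (I₂ →ₗ[Rxy] Rxy ⧸ I₂) (I₃ →ₗ[Rxy] Rxy ⧸ I₃)).comp
            (LinearMap.snd Rxy (I₁ →ₗ[Rxy] Rxy ⧸ I₁)
              ((I₂ →ₗ[Rxy] Rxy ⧸ I₂) × (I₃ →ₗ[Rxy] Rxy ⧸ I₃)))))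
        - ((LinearMap.llcomp Rxy I₃ (Rxy ⧸ I₃) (Rxy ⧸ I₂) (quotFactor h32)).comp
          ((LinearMap.snd Rxy (I₂ →ₗ[Rxy] Rxy ⧸ I₂) (I₃ →ₗ[Rxy] Rxy ⧸ I₃)).comp
            (LinearMap.snd Rxy (I₁ →ₗ[Rxy] Rxy ⧸ I₁)
              ((I₂ →ₗ[Rxy] Rxy ⧸ I₂) × (I₃ →ₗ[Rxy] Rxy ⧸ I₃))))))

set_option linter.unusedSectionVars false

/-- Endomorphisms preserving a two-step flag. -/
def parab {V : Type*} [AddCommGroup V] [Module ℂ V] (W₁ W₂ : Submodule ℂ V) :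
    Submodule ℂ (Module.End ℂ V) where
  carrier := {p | (∀ v ∈ W₁, p v ∈ W₁) ∧ ∀ v ∈ W₂, p v ∈ W₂}
  zero_mem' := ⟨fun v _ => by simp, fun v _ => by simp⟩
  add_mem' := fun ha hb => ⟨fun v hv => W₁.add_mem (ha.1 v hv) (hb.1 v hv),
    fun v hv => W₂.add_mem (ha.2 v hv) (hb.2 v hv)⟩
  smul_mem' := fun c _ ha => ⟨fun v hv => W₁.smul_mem c (ha.1 v hv),
    fun v hv => W₂.smul_mem c (ha.2 v hv)⟩

/-- Endomorphisms strictly shifting the flag `V ⊇ W₁ ⊇ W₂ ⊇ 0`. -/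
def nilp {V : Type*} [AddCommGroup V] [Module ℂ V] (W₁ W₂ : Submodule ℂ V) :
    Submodule ℂ (Module.End ℂ V) where
  carrier := {p | (∀ v, p v ∈ W₁) ∧ (∀ v ∈ W₁, p v ∈ W₂) ∧ ∀ v ∈ W₂, p v = 0}
  zero_mem' := ⟨fun v => by simp, fun v _ => by simp, fun v _ => by simp⟩
  add_mem' := fun ha hb => ⟨fun v => W₁.add_mem (ha.1 v) (hb.1 v),
    fun v hv => W₂.add_mem (ha.2.1 v hv) (hb.2.1 v hv),
    fun v hv => by simp [ha.2.2 v hv, hb.2.2 v hv]⟩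
  smul_mem' := fun c _ ha => ⟨fun v => W₁.smul_mem c (ha.1 v),
    fun v hv => W₂.smul_mem c (ha.2.1 v hv),
    fun v hv => by simp [ha.2.2 v hv]⟩

section trace
variable {V : Type*} [AddCommGroup V] [Module ℂ V] [FiniteDimensional ℂ V]

lemma trace_mul_smulRight (C : Module.End ℂ V) (ξ : V →ₗ[ℂ] ℂ) (v : V) :
    LinearMap.trace ℂ V (C * ξ.smulRight v) = ξ (C v) := by
  have : C * ξ.smulRight v = ξ.smulRight (C v) := by
    ext w; simp
  rw [this]
  simp

lemma mem_of_forall_dual (W : Submodule ℂ V) (v : V)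
    (h : ∀ ξ : V →ₗ[ℂ] ℂ, (∀ w ∈ W, ξ w = 0) → ξ v = 0) : v ∈ W := by
  by_contra hv
  obtain ⟨f, hf, hW⟩ := Submodule.exists_le_ker_of_notMem hv
  exact hf (h f (fun w hw => hW hw))

lemma mem_nilp_iff (W₁ W₂ : Submodule ℂ V) (h : W₂ ≤ W₁) (C : Module.End ℂ V) :
    C ∈ nilp W₁ W₂ ↔ ∀ p ∈ parab W₁ W₂, LinearMap.trace ℂ V (C * p) = 0 := by
  constructor
  · rintro ⟨h0, h1, h2⟩ p ⟨p1, p2⟩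
    apply IsNilpotent.eq_zero
    apply LinearMap.isNilpotent_trace_of_isNilpotent
    refine ⟨3, ?_⟩
    ext v
    simp only [pow_succ, pow_zero, one_mul, Module.End.mul_apply, LinearMap.zero_apply]
    exact h2 _ (p2 _ (h1 _ (p1 _ (h0 _))))
  · intro H
    refine ⟨fun v => ?_, fun v hv => ?_, fun v hv => ?_⟩
    · apply mem_of_forall_dual
      intro ξ hξ
      rw [← trace_mul_smulRight]
      apply H
      exact ⟨fun w hw => by simp [hξ w hw], fun w hw => by simp [hξ w (h hw)]⟩
    · apply mem_of_forall_dual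
      intro ξ hξ
      rw [← trace_mul_smulRight]
      apply H
      exact ⟨fun w hw => by simpa using W₁.smul_mem _ hv, fun w hw => by simp [hξ w hw]⟩
    · have : C v ∈ (⊥ : Submodule ℂ V) := by
        apply mem_of_forall_dual
        intro ξ hξ
        rw [← trace_mul_smulRight]
        apply H
        exact ⟨fun w hw => by simpa using W₁.smul_mem _ (h hv),
          fun w hw => by simpa using W₂.smul_mem _ hv⟩
      simpa using this

variable (V) in
/-- The trace form. -/
def trForm : LinearMap.BilinForm ℂ (Module.End ℂ V) :=
  (LinearMap.mul ℂ (Module.End ℂ V)).compr₂ (LinearMap.trace ℂ V)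

lemma trForm_apply (C p : Module.End ℂ V) : trForm V C p = LinearMap.trace ℂ V (C * p) := rfl

lemma trForm_symm : (trForm V).IsSymm := ⟨fun x y => by
  simp only [trForm_apply]
  exact LinearMap.trace_mul_comm ℂ x y⟩

lemma trForm_nondeg : (trForm V).Nondegenerate := by
  refine (LinearMap.IsRefl.nondegenerate_iff_separatingLeft (trForm_symm (V := V)).isRefl).2 ?_
  intro C hC
  have := (mem_nilp_iff (⊥ : Submodule ℂ V) ⊥ le_rfl C).2 (fun p _ => hC p)
  ext v
  simpa using this.1 v

/-- The linearised commutator. -/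
def comd (A B : Module.End ℂ V) (P : Submodule ℂ (Module.End ℂ V)) :
    (P × P) →ₗ[ℂ] Module.End ℂ V :=
  ((LinearMap.mulLeft ℂ A - LinearMap.mulRight ℂ A).comp P.subtype).comp (LinearMap.snd ℂ P P)
   + ((LinearMap.mulRight ℂ B - LinearMap.mulLeft ℂ B).comp P.subtype).comp (LinearMap.fst ℂ P P)

lemma comd_apply (A B : Module.End ℂ V) (P : Submodule ℂ (Module.End ℂ V)) (a b : P) :
    comd A B P (a, b) = (A * b - b * A) + (a * B - B * a) := rfl

/-- Endomorphisms commuting with `A`, `B` modulo `N`. -/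
def centr (A B : Module.End ℂ V) (N : Submodule ℂ (Module.End ℂ V)) :
    Submodule ℂ (Module.End ℂ V) :=
  N.comap (LinearMap.mulRight ℂ A - LinearMap.mulLeft ℂ A) ⊓
  N.comap (LinearMap.mulRight ℂ B - LinearMap.mulLeft ℂ B)

lemma mem_centr (A B : Module.End ℂ V) (N : Submodule ℂ (Module.End ℂ V)) (C : Module.End ℂ V) :
    C ∈ centr A B N ↔ C * A - A * C ∈ N ∧ C * B - B * C ∈ N := Iff.rfl

lemma orth_parab (W₁ W₂ : Submodule ℂ V) (h : W₂ ≤ W₁) :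
    (trForm V).orthogonal (parab W₁ W₂) = nilp W₁ W₂ := by
  ext C
  rw [mem_nilp_iff _ _ h]
  refine forall₂_congr fun p _ => ?_
  change trForm V p C = 0 ↔ _
  rw [trForm_apply, LinearMap.trace_mul_comm]

lemma orth_range (A B : Module.End ℂ V) (W₁ W₂ : Submodule ℂ V) (h : W₂ ≤ W₁) :
    (trForm V).orthogonal (LinearMap.range (comd A B (parab W₁ W₂)))
      = centr A B (nilp W₁ W₂) := by
  have key : ∀ (A C p : Module.End ℂ V), LinearMap.trace ℂ V ((A * p - p * A) * C)
      = LinearMap.trace ℂ V ((C * A - A * C) * p) := by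
    intro A C p
    simp only [sub_mul, map_sub]
    rw [LinearMap.trace_mul_comm ℂ (A * p) C, mul_assoc p A C,
      LinearMap.trace_mul_comm ℂ p (A * C), mul_assoc C A p]
  ext C
  rw [mem_centr, mem_nilp_iff _ _ h, mem_nilp_iff _ _ h]
  constructor
  · intro H
    constructor
    · intro p hp
      have := H _ ⟨(0, ⟨p, hp⟩), rfl⟩
      change trForm V _ C = 0 at this
      rw [comd_apply, trForm_apply] at this
      rw [← key]; simpa using this
    · intro p hp
      have := H _ ⟨(⟨p, hp⟩, 0), rfl⟩
      change trForm V _ C = 0 at this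
      rw [comd_apply, trForm_apply] at this
      rw [← key, ← neg_sub, neg_mul, map_neg, neg_eq_zero]; simpa using this
  · rintro ⟨H1, H2⟩ _ ⟨⟨a, b⟩, rfl⟩
    change trForm V _ C = 0
    rw [comd_apply, trForm_apply, add_mul, map_add, key, H1 _ b.2,
      ← neg_sub (B * (a : Module.End ℂ V)), neg_mul, map_neg, key, H2 _ a.2]
    simp

lemma finrank_centr (A B : Module.End ℂ V) (W₁ W₂ : Submodule ℂ V) (h : W₂ ≤ W₁) :
    Module.finrank ℂ (centr A B (nilp W₁ W₂)) +
      Module.finrank ℂ (LinearMap.range (comd A B (parab W₁ W₂)))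
    = Module.finrank ℂ (nilp W₁ W₂) + Module.finrank ℂ (parab W₁ W₂) := by
  rw [← orth_range A B W₁ W₂ h, ← orth_parab W₁ W₂ h,
    LinearMap.BilinForm.finrank_orthogonal (trForm_nondeg (V := V)),
    LinearMap.BilinForm.finrank_orthogonal (trForm_nondeg (V := V))]
  have h1 := Submodule.finrank_le (LinearMap.range (comd A B (parab W₁ W₂)))
  have h2 := Submodule.finrank_le (parab W₁ W₂)
  omega

end trace

section tangent

/-- The image of `J` in `R ⧸ I`. -/
def Wof {I J : Ideal Rxy} (h : I ≤ J) : Submodule ℂ (Rxy ⧸ I) :=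
  (LinearMap.ker (quotFactor h)).restrictScalars ℂ

lemma mem_Wof {I J : Ideal Rxy} (h : I ≤ J) (v : Rxy ⧸ I) :
    v ∈ Wof h ↔ quotFactor h v = 0 := Iff.rfl

/-- The quotient map, over `ℂ`. -/
def qm (I : Ideal Rxy) : Rxy →ₗ[ℂ] Rxy ⧸ I := (Submodule.mkQ I).restrictScalars ℂ

lemma qm_surj (I : Ideal Rxy) : Function.Surjective (qm I) := Submodule.mkQ_surjective I

lemma qm_eq_zero (I : Ideal Rxy) (r : Rxy) : qm I r = 0 ↔ r ∈ I :=
  Submodule.Quotient.mk_eq_zero I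

lemma qm_mul (I : Ideal Rxy) (p r : Rxy) : qm I (p * r) = p • qm I r := rfl

lemma quotFactor_qm {I J : Ideal Rxy} (h : I ≤ J) (r : Rxy) :
    quotFactor h (qm I r) = qm J r := rfl

lemma quotFactor_csmul {I J : Ideal Rxy} (h : I ≤ J) (c : ℂ) (v : Rxy ⧸ I) :
    quotFactor h (c • v) = c • quotFactor h v :=
  ((quotFactor h).restrictScalars ℂ).map_smul c v

lemma qm_mem_Wof {I J : Ideal Rxy} (h : I ≤ J) (r : Rxy) : qm I r ∈ Wof h ↔ r ∈ J := by
  rw [mem_Wof, quotFactor_qm, qm_eq_zero]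

lemma smul_mem_Wof {I J : Ideal Rxy} (h : I ≤ J) (p : Rxy) {v : Rxy ⧸ I} (hv : v ∈ Wof h) :
    p • v ∈ Wof h := (LinearMap.ker (quotFactor h)).smul_mem p hv

lemma Wof_mono {I J K : Ideal Rxy} (h : I ≤ J) (h' : J ≤ K) : Wof h ≤ Wof (h.trans h') := by
  intro v hv
  obtain ⟨r, rfl⟩ := qm_surj I v
  rw [qm_mem_Wof] at *
  exact h' hv

/-- Multiplication by a variable. -/
def mulX (I : Ideal Rxy) (i : Fin 2) : Module.End ℂ (Rxy ⧸ I) := Algebra.lsmul ℂ ℂ _ (X i : Rxy)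

lemma mulX_apply (I : Ideal Rxy) (i : Fin 2) (v : Rxy ⧸ I) : mulX I i v = (X i : Rxy) • v := rfl

/-- The failure of linearity of `D`. -/
def dev (I : Ideal Rxy) (i : Fin 2) : (Rxy →ₗ[ℂ] Rxy ⧸ I) →ₗ[ℂ] (Rxy →ₗ[ℂ] Rxy ⧸ I) where
  toFun D := D.comp (Algebra.lsmul ℂ ℂ Rxy (X i : Rxy)) - (mulX I i).comp D
  map_add' D E := by
    ext r; simp [LinearMap.add_comp, LinearMap.comp_add]; abel
  map_smul' c D := by
    ext r; simp [LinearMap.smul_comp, LinearMap.comp_smul, smul_sub]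

lemma dev_apply (I : Ideal Rxy) (i : Fin 2) (D : Rxy →ₗ[ℂ] Rxy ⧸ I) (r : Rxy) :
    dev I i D r = D (X i * r) - (X i : Rxy) • D r := rfl

/-- Linear maps `R → R/I` inducing an `R`-linear map `J → R/J`. -/
def DD {I J : Ideal Rxy} (h : I ≤ J) : Submodule ℂ (Rxy →ₗ[ℂ] Rxy ⧸ I) where
  carrier := {D | ∀ r ∈ J, ∀ i, dev I i D r ∈ Wof h}
  zero_mem' := fun r _ i => by simp
  add_mem' := fun ha hb r hr i => by
    rw [map_add]; exact (Wof h).add_mem (ha r hr i) (hb r hr i)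
  smul_mem' := fun c D ha r hr i => by
    rw [map_smul]; exact (Wof h).smul_mem c (ha r hr i)

lemma DD_lin {I J : Ideal Rxy} (h : I ≤ J) (D : DD h) (p : Rxy) :
    ∀ r ∈ J, quotFactor h (D.1 (p * r)) = p • quotFactor h (D.1 r) := by
  induction p using MvPolynomial.induction_on with
  | C a =>
    intro r _
    rw [← MvPolynomial.smul_eq_C_mul, map_smul, quotFactor_csmul]
    rw [← MvPolynomial.algebraMap_eq, algebraMap_smul]
  | add p q hp hq =>
    intro r hr
    rw [add_mul, map_add, map_add, hp r hr, hq r hr, add_smul]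
  | mul_X p i hp =>
    intro r hr
    rw [mul_assoc, hp _ (J.mul_mem_left _ hr), mul_smul]
    congr 1
    have := D.2 r hr i
    rw [mem_Wof, dev_apply, map_sub, sub_eq_zero, map_smul] at this
    exact this

/-- The induced `R`-linear map. -/
def res {I J : Ideal Rxy} (h : I ≤ J) : DD h →ₗ[ℂ] (J →ₗ[Rxy] Rxy ⧸ J) where
  toFun D :=
    { toFun := fun r => quotFactor h (D.1 r.1)
      map_add' := fun r s => by simp
      map_smul' := fun p r => DD_lin h D p r.1 r.2 }
  map_add' D E := by ext r; simp
  map_smul' c D := by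
    ext r
    exact quotFactor_csmul h c (D.1 r.1)

lemma res_apply {I J : Ideal Rxy} (h : I ≤ J) (D : DD h) (r : J) :
    res h D r = quotFactor h (D.1 r.1) := rfl

lemma mem_DD_of_eq {I J : Ideal Rxy} (h : I ≤ J) (D : Rxy →ₗ[ℂ] Rxy ⧸ I)
    (f : J →ₗ[Rxy] Rxy ⧸ J) (hf : ∀ r : J, quotFactor h (D r.1) = f r) : D ∈ DD h := by
  intro r hr i
  rw [mem_Wof, dev_apply, map_sub, map_smul]
  have h1 := hf ((X i : Rxy) • (⟨r, hr⟩ : J))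
  have h2 := hf ⟨r, hr⟩
  rw [map_smul, ← h2] at h1
  rw [sub_eq_zero]
  exact h1

lemma mem_flagTangent3 (I₁ I₂ I₃ : Ideal Rxy) (h21 : I₂ ≤ I₁) (h32 : I₃ ≤ I₂)
    (t : (I₁ →ₗ[Rxy] Rxy ⧸ I₁) × (I₂ →ₗ[Rxy] Rxy ⧸ I₂) × (I₃ →ₗ[Rxy] Rxy ⧸ I₃)) :
    t ∈ flagTangent3 I₁ I₂ I₃ h21 h32 ↔
      (∀ a : I₂, t.1 ⟨a.1, h21 a.2⟩ = quotFactor h21 (t.2.1 a)) ∧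
      (∀ a : I₃, t.2.1 ⟨a.1, h32 a.2⟩ = quotFactor h32 (t.2.2 a)) := by
  unfold flagTangent3
  rw [Submodule.mem_inf, LinearMap.mem_ker, LinearMap.mem_ker]
  constructor
  · rintro ⟨ha, hb⟩
    exact ⟨fun a => sub_eq_zero.1 (DFunLike.congr_fun ha a),
      fun a => sub_eq_zero.1 (DFunLike.congr_fun hb a)⟩
  · rintro ⟨ha, hb⟩
    exact ⟨LinearMap.ext fun a => sub_eq_zero.2 (ha a),
      LinearMap.ext fun a => sub_eq_zero.2 (hb a)⟩

lemma quotFactor_trans {I J K : Ideal Rxy} (h : I ≤ J) (h' : J ≤ K) (v : Rxy ⧸ I) :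
    quotFactor (h.trans h') v = quotFactor h' (quotFactor h v) := by
  obtain ⟨r, rfl⟩ := qm_surj I v
  rfl

lemma quotFactor_refl {I : Ideal Rxy} (v : Rxy ⧸ I) : quotFactor (le_refl I) v = v := by
  obtain ⟨r, rfl⟩ := qm_surj I v
  rfl

variable (I₁ I₂ I₃ : Ideal Rxy) (h21 : I₂ ≤ I₁) (h32 : I₃ ≤ I₂)

/-- The space of `D` inducing a tangent vector. -/
def DDD : Submodule ℂ (Rxy →ₗ[ℂ] Rxy ⧸ I₃) :=
  DD (h32.trans h21) ⊓ (DD h32 ⊓ DD (le_refl I₃))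

/-- The map from `DDD` to the tangent space. -/
def Phi : DDD I₁ I₂ I₃ h21 h32 →ₗ[ℂ] flagTangent3 I₁ I₂ I₃ h21 h32 where
  toFun D := ⟨(res (h32.trans h21) ⟨D.1, D.2.1⟩, res h32 ⟨D.1, D.2.2.1⟩,
      res (le_refl I₃) ⟨D.1, D.2.2.2⟩), by
    rw [mem_flagTangent3]
    refine ⟨fun a => ?_, fun a => ?_⟩
    · simp only [res_apply]; exact quotFactor_trans h32 h21 _
    · simp only [res_apply]; rw [quotFactor_refl]⟩
  map_add' D E := by
    apply Subtype.ext
    refine Prod.ext ?_ (Prod.ext ?_ ?_)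
    · exact map_add (res (h32.trans h21)) ⟨D.1, D.2.1⟩ ⟨E.1, E.2.1⟩
    · exact map_add (res h32) ⟨D.1, D.2.2.1⟩ ⟨E.1, E.2.2.1⟩
    · exact map_add (res (le_refl I₃)) ⟨D.1, D.2.2.2⟩ ⟨E.1, E.2.2.2⟩
  map_smul' c D := by
    apply Subtype.ext
    refine Prod.ext ?_ (Prod.ext ?_ ?_)
    · exact map_smul (res (h32.trans h21)) c ⟨D.1, D.2.1⟩
    · exact map_smul (res h32) c ⟨D.1, D.2.2.1⟩
    · exact map_smul (res (le_refl I₃)) c ⟨D.1, D.2.2.2⟩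

/-- One-step correction. -/
lemma exists_corr {I J K : Ideal Rxy} (h : I ≤ J) (hK : K ≤ J)
    (D : Rxy →ₗ[ℂ] Rxy ⧸ I) (f : J →ₗ[Rxy] Rxy ⧸ J)
    (hf : ∀ r : J, r.1 ∈ K → quotFactor h (D r.1) = f r) :
    ∃ D' : Rxy →ₗ[ℂ] Rxy ⧸ I, (∀ r ∈ K, D' r = D r) ∧
      ∀ r : J, quotFactor h (D' r.1) = f r := by
  have hs : Function.Surjective ((quotFactor h).restrictScalars ℂ) := by
    intro v
    obtain ⟨r, rfl⟩ := qm_surj J v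
    exact ⟨qm I r, rfl⟩
  obtain ⟨s, hs⟩ := LinearMap.exists_rightInverse_of_surjective _ (LinearMap.range_eq_top.2 hs)
  have hs' : ∀ v, quotFactor h (s v) = v := fun v => DFunLike.congr_fun hs v
  let J' : Submodule ℂ Rxy := J.restrictScalars ℂ
  let f' : J' →ₗ[ℂ] Rxy ⧸ J := f.restrictScalars ℂ
  let e : J' →ₗ[ℂ] Rxy ⧸ I :=
    s.comp (f' - (((quotFactor h).restrictScalars ℂ).comp D).comp J'.subtype)
  obtain ⟨E, hE⟩ := LinearMap.exists_extend e
  have hE' : ∀ r : J, E r.1 = s (f r - quotFactor h (D r.1)) := fun r => DFunLike.congr_fun hE r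
  refine ⟨D + E, fun r hr => ?_, fun r => ?_⟩
  · rw [LinearMap.add_apply, hE' ⟨r, hK hr⟩, hf ⟨r, hK hr⟩ hr, sub_self, map_zero, add_zero]
  · rw [LinearMap.add_apply, map_add, hE', hs']
    abel

lemma Phi_surj : Function.Surjective (Phi I₁ I₂ I₃ h21 h32) := by
  rintro ⟨⟨f, h, g⟩, ht⟩
  rw [mem_flagTangent3] at ht
  obtain ⟨ht1, ht2⟩ := ht
  simp only at ht1 ht2
  obtain ⟨D3, -, h3⟩ := exists_corr (le_refl I₃) (bot_le : (⊥ : Ideal Rxy) ≤ I₃) 0 g (by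
    rintro ⟨r, hr⟩ hr0
    have : r = 0 := by simpa using hr0
    subst this
    have : (⟨0, hr⟩ : I₃) = 0 := rfl
    rw [this]
    simp)
  obtain ⟨D2, h2', h2⟩ := exists_corr h32 h32 D3 h (by
    rintro ⟨r, hr⟩ hr0
    have := ht2 ⟨r, hr0⟩
    rw [this, ← h3, quotFactor_refl])
  obtain ⟨D1, h1', h1⟩ := exists_corr (h32.trans h21) h21 D2 f (by
    rintro ⟨r, hr⟩ hr0
    have := ht1 ⟨r, hr0⟩
    rw [this, ← h2, quotFactor_trans h32 h21])
  have k2 : ∀ r : I₂, quotFactor h32 (D1 r.1) = h r := fun r => by rw [h1' _ r.2, h2]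
  have k3 : ∀ r : I₃, quotFactor (le_refl I₃) (D1 r.1) = g r := fun r => by
    rw [h1' _ (h32 r.2), h2' _ r.2, h3]
  refine ⟨⟨D1, mem_DD_of_eq _ _ f h1, mem_DD_of_eq _ _ h k2, mem_DD_of_eq _ _ g k3⟩, ?_⟩
  apply Subtype.ext
  refine Prod.ext (LinearMap.ext h1) (Prod.ext (LinearMap.ext k2) (LinearMap.ext k3))

/-- The parabolic subalgebra. -/
abbrev PP : Submodule ℂ (Module.End ℂ (Rxy ⧸ I₃)) := parab (Wof (h32.trans h21)) (Wof h32)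

lemma dev_comp_qm (I : Ideal Rxy) (i : Fin 2) (p : Module.End ℂ (Rxy ⧸ I)) (r : Rxy) :
    dev I i (p.comp (qm I)) r = p ((X i : Rxy) • qm I r) - (X i : Rxy) • p (qm I r) := rfl

/-- Inclusion of the parabolic in `DDD`. -/
def inclP : PP I₁ I₂ I₃ h21 h32 →ₗ[ℂ] DDD I₁ I₂ I₃ h21 h32 where
  toFun p := ⟨p.1.comp (qm I₃), by
    refine ⟨fun r hr i => ?_, fun r hr i => ?_, fun r hr i => ?_⟩
    · rw [dev_comp_qm]
      have := (qm_mem_Wof (h32.trans h21) r).2 hr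
      exact Submodule.sub_mem _ (p.2.1 _ (smul_mem_Wof _ _ this))
        (smul_mem_Wof _ _ (p.2.1 _ this))
    · rw [dev_comp_qm]
      have := (qm_mem_Wof h32 r).2 hr
      exact Submodule.sub_mem _ (p.2.2 _ (smul_mem_Wof _ _ this))
        (smul_mem_Wof _ _ (p.2.2 _ this))
    · rw [dev_comp_qm, (qm_eq_zero I₃ r).2 hr]
      simp⟩
  map_add' p q := rfl
  map_smul' c p := rfl

lemma inclP_inj : Function.Injective (inclP I₁ I₂ I₃ h21 h32) := by
  intro p q h
  apply Subtype.ext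
  ext v
  obtain ⟨r, rfl⟩ := qm_surj I₃ v
  exact DFunLike.congr_fun (congrArg Subtype.val h) r

lemma exists_factor (I : Ideal Rxy) (D : Rxy →ₗ[ℂ] Rxy ⧸ I) (hD : ∀ r ∈ I, D r = 0) :
    ∃ p : Module.End ℂ (Rxy ⧸ I), ∀ r, p (qm I r) = D r := by
  obtain ⟨s, hs⟩ := LinearMap.exists_rightInverse_of_surjective _
    (LinearMap.range_eq_top.2 (qm_surj I))
  have hs' : ∀ v, qm I (s v) = v := fun v => DFunLike.congr_fun hs v
  refine ⟨D.comp s, fun r => ?_⟩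
  rw [LinearMap.comp_apply, ← sub_eq_zero, ← map_sub]
  apply hD
  rw [← qm_eq_zero, map_sub, hs', sub_self]

lemma range_inclP :
    LinearMap.range (inclP I₁ I₂ I₃ h21 h32) = LinearMap.ker (Phi I₁ I₂ I₃ h21 h32) := by
  ext D
  rw [LinearMap.mem_ker]
  constructor
  · rintro ⟨p, rfl⟩
    apply Subtype.ext
    refine Prod.ext (LinearMap.ext fun r => ?_)
      (Prod.ext (LinearMap.ext fun r => ?_) (LinearMap.ext fun r => ?_))
    · exact p.2.1 _ ((qm_mem_Wof (h32.trans h21) r.1).2 r.2)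
    · exact p.2.2 _ ((qm_mem_Wof h32 r.1).2 r.2)
    · have : p.1 (qm I₃ r.1) = 0 := by rw [(qm_eq_zero I₃ r.1).2 r.2, map_zero]
      change quotFactor (le_refl I₃) (p.1 (qm I₃ r.1)) = 0
      rw [this, map_zero]
  · intro h
    have h := congrArg Subtype.val h
    have e1 : ∀ r : I₁, quotFactor (h32.trans h21) (D.1 r.1) = 0 :=
      fun r => DFunLike.congr_fun (congrArg Prod.fst h) r
    have e2 : ∀ r : I₂, quotFactor h32 (D.1 r.1) = 0 :=
      fun r => DFunLike.congr_fun (congrArg (fun t => t.2.1) h) r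
    have e3 : ∀ r : I₃, quotFactor (le_refl I₃) (D.1 r.1) = 0 :=
      fun r => DFunLike.congr_fun (congrArg (fun t => t.2.2) h) r
    obtain ⟨p, hp⟩ := exists_factor I₃ D.1 (fun r hr => by
      have := e3 ⟨r, hr⟩; rwa [quotFactor_refl] at this)
    refine ⟨⟨p, fun v hv => ?_, fun v hv => ?_⟩, Subtype.ext (LinearMap.ext hp)⟩
    · obtain ⟨r, rfl⟩ := qm_surj I₃ v
      rw [hp]
      exact e1 ⟨r, (qm_mem_Wof _ r).1 hv⟩
    · obtain ⟨r, rfl⟩ := qm_surj I₃ v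
      rw [hp]
      exact e2 ⟨r, (qm_mem_Wof _ r).1 hv⟩

/-- A linear section of the quotient map. -/
def sec (I : Ideal Rxy) : (Rxy ⧸ I) →ₗ[ℂ] Rxy :=
  Classical.choose (LinearMap.exists_rightInverse_of_surjective _
    (LinearMap.range_eq_top.2 (qm_surj I)))

lemma qm_sec (I : Ideal Rxy) (v : Rxy ⧸ I) : qm I (sec I v) = v :=
  DFunLike.congr_fun (Classical.choose_spec (LinearMap.exists_rightInverse_of_surjective _
    (LinearMap.range_eq_top.2 (qm_surj I)))) v

lemma dev_zero (D : DDD I₁ I₂ I₃ h21 h32) (i : Fin 2) (r : Rxy) (hr : r ∈ I₃) :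
    dev I₃ i D.1 r = 0 := by
  have := D.2.2.2 r hr i
  rwa [mem_Wof, quotFactor_refl] at this

lemma dev_sec (D : DDD I₁ I₂ I₃ h21 h32) (i : Fin 2) (r : Rxy) :
    dev I₃ i D.1 (sec I₃ (qm I₃ r)) = dev I₃ i D.1 r := by
  rw [← sub_eq_zero, ← map_sub]
  apply dev_zero
  rw [← qm_eq_zero, map_sub, qm_sec, sub_self]

/-- `dev` as a map to the parabolic. -/
def devP (i : Fin 2) : DDD I₁ I₂ I₃ h21 h32 →ₗ[ℂ] PP I₁ I₂ I₃ h21 h32 where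
  toFun D := ⟨(dev I₃ i D.1).comp (sec I₃), by
    refine ⟨fun v hv => D.2.1 _ ?_ i, fun v hv => D.2.2.1 _ ?_ i⟩
    · rw [← qm_mem_Wof (h32.trans h21), qm_sec]; exact hv
    · rw [← qm_mem_Wof h32, qm_sec]; exact hv⟩
  map_add' D E := by
    apply Subtype.ext
    refine LinearMap.ext fun v => ?_
    simp
  map_smul' c D := by
    apply Subtype.ext
    refine LinearMap.ext fun v => ?_
    simp

lemma devP_qm (D : DDD I₁ I₂ I₃ h21 h32) (i : Fin 2) (r : Rxy) :
    (devP I₁ I₂ I₃ h21 h32 i D).1 (qm I₃ r) = dev I₃ i D.1 r := dev_sec I₁ I₂ I₃ h21 h32 D i r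

/-- Full data of `D`. -/
def EE : DDD I₁ I₂ I₃ h21 h32 →ₗ[ℂ]
    ((PP I₁ I₂ I₃ h21 h32 × PP I₁ I₂ I₃ h21 h32) × (Rxy ⧸ I₃)) :=
  ((devP I₁ I₂ I₃ h21 h32 0).prod (devP I₁ I₂ I₃ h21 h32 1)).prod
    ((LinearMap.applyₗ (1 : Rxy)).comp (Submodule.subtype _))

lemma EE_apply (D : DDD I₁ I₂ I₃ h21 h32) : EE I₁ I₂ I₃ h21 h32 D =
    ((devP I₁ I₂ I₃ h21 h32 0 D, devP I₁ I₂ I₃ h21 h32 1 D), D.1 1) := rfl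

lemma EE_inj : Function.Injective (EE I₁ I₂ I₃ h21 h32) := by
  rw [injective_iff_map_eq_zero]
  intro D hD
  rw [EE_apply] at hD
  have e0 : devP I₁ I₂ I₃ h21 h32 0 D = 0 := congrArg (fun t => t.1.1) hD
  have e1 : devP I₁ I₂ I₃ h21 h32 1 D = 0 := congrArg (fun t => t.1.2) hD
  have e2 : D.1 1 = 0 := congrArg (fun t => t.2) hD
  have key : ∀ i r, D.1 (X i * r) = (X i : Rxy) • D.1 r := by
    intro i r
    rw [← sub_eq_zero, ← dev_apply, ← devP_qm I₁ I₂ I₃ h21 h32]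
    fin_cases i
    · simp [e0]
    · simp [e1]
  apply Subtype.ext
  apply LinearMap.ext
  intro p
  change D.1 p = 0
  induction p using MvPolynomial.induction_on with
  | C a =>
    rw [← mul_one (C a), ← MvPolynomial.smul_eq_C_mul, map_smul, e2, smul_zero]
  | add p q hp hq => rw [map_add, hp, hq, add_zero]
  | mul_X p i hp => rw [mul_comm, key, hp, smul_zero]

/-- Recursive construction on monomials. -/
def recD (I : Ideal Rxy) (a b : Module.End ℂ (Rxy ⧸ I)) (v : Rxy ⧸ I) : ℕ → ℕ → Rxy ⧸ I
  | 0, 0 => v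
  | 0, j + 1 => (X 1 : Rxy) • recD I a b v 0 j + b (qm I (X 1 ^ j))
  | i + 1, j => (X 0 : Rxy) • recD I a b v i j + a (qm I (X 0 ^ i * X 1 ^ j))

lemma recD_right (I : Ideal Rxy) (a b : Module.End ℂ (Rxy ⧸ I)) (v : Rxy ⧸ I)
    (hab : ∀ w, (X 0 : Rxy) • b w - b ((X 0 : Rxy) • w)
      + (a ((X 1 : Rxy) • w) - (X 1 : Rxy) • a w) = 0) (i j : ℕ) :
    recD I a b v i (j + 1) = (X 1 : Rxy) • recD I a b v i j + b (qm I (X 0 ^ i * X 1 ^ j)) := by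
  induction i with
  | zero => rw [recD]; simp
  | succ i ih =>
    rw [recD, ih, recD]
    have e1 : qm I (X 0 ^ i * X 1 ^ (j + 1)) = (X 1 : Rxy) • qm I (X 0 ^ i * X 1 ^ j) := by
      rw [← qm_mul]; congr 1; ring
    have e2 : qm I (X 0 ^ (i + 1) * X 1 ^ j) = (X 0 : Rxy) • qm I (X 0 ^ i * X 1 ^ j) := by
      rw [← qm_mul]; congr 1; ring
    rw [e1, e2]
    have := hab (qm I (X 0 ^ i * X 1 ^ j))
    rw [smul_add, smul_add, smul_comm (X 0 : Rxy) (X 1 : Rxy)]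
    rw [← sub_eq_zero, ← this]
    abel

lemma monomial_eq_XX (s : Fin 2 →₀ ℕ) :
    (monomial s (1 : ℂ) : Rxy) = X 0 ^ (s 0) * X 1 ^ (s 1) := by
  rw [MvPolynomial.monomial_eq]
  simp [Finsupp.prod_fintype]

lemma exists_D (I : Ideal Rxy) (a b : Module.End ℂ (Rxy ⧸ I)) (v : Rxy ⧸ I)
    (hab : ∀ w, (X 0 : Rxy) • b w - b ((X 0 : Rxy) • w)
      + (a ((X 1 : Rxy) • w) - (X 1 : Rxy) • a w) = 0) :
    ∃ D : Rxy →ₗ[ℂ] Rxy ⧸ I, D 1 = v ∧ (∀ r, dev I 0 D r = a (qm I r)) ∧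
      ∀ r, dev I 1 D r = b (qm I r) := by
  let D : Rxy →ₗ[ℂ] Rxy ⧸ I :=
    (MvPolynomial.basisMonomials (Fin 2) ℂ).constr ℂ (fun s => recD I a b v (s 0) (s 1))
  have hD : ∀ s : Fin 2 →₀ ℕ, D (monomial s 1) = recD I a b v (s 0) (s 1) := by
    intro s
    have := (MvPolynomial.basisMonomials (Fin 2) ℂ).constr_basis ℂ
      (fun s => recD I a b v (s 0) (s 1)) s
    rwa [MvPolynomial.coe_basisMonomials] at this
  refine ⟨D, ?_, ?_, ?_⟩
  · have := hD 0
    rw [show (monomial (0 : Fin 2 →₀ ℕ) (1 : ℂ) : Rxy) = 1 from rfl] at this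
    rw [this]
    simp [recD]
  · intro r
    have : dev I 0 D = a.comp (qm I) := by
      apply (MvPolynomial.basisMonomials (Fin 2) ℂ).ext
      intro s
      rw [MvPolynomial.coe_basisMonomials, dev_apply, LinearMap.comp_apply]
      have e : (X 0 * monomial s 1 : Rxy) = monomial (Finsupp.single 0 1 + s) 1 := by
        rw [X, monomial_mul, one_mul]
      change D (X _ * monomial s 1) - (X _ : Rxy) • D (monomial s 1) = _
      rw [e, hD, hD]
      change _ = a (qm I (monomial s 1))
      rw [monomial_eq_XX]
      simp only [Finsupp.add_apply, Finsupp.single_apply]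
      simp [add_comm 1, recD]
    rw [this]; rfl
  · intro r
    have : dev I 1 D = b.comp (qm I) := by
      apply (MvPolynomial.basisMonomials (Fin 2) ℂ).ext
      intro s
      rw [MvPolynomial.coe_basisMonomials, dev_apply, LinearMap.comp_apply]
      have e : (X 1 * monomial s 1 : Rxy) = monomial (Finsupp.single 1 1 + s) 1 := by
        rw [X, monomial_mul, one_mul]
      change D (X _ * monomial s 1) - (X _ : Rxy) • D (monomial s 1) = _
      rw [e, hD, hD]
      change _ = b (qm I (monomial s 1))
      rw [monomial_eq_XX]
      simp only [Finsupp.add_apply, Finsupp.single_apply]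
      simp [add_comm 1, recD_right I a b v hab]
    rw [this]; rfl

lemma range_EE [FiniteDimensional ℂ (Rxy ⧸ I₃)] : LinearMap.range (EE I₁ I₂ I₃ h21 h32) =
    LinearMap.ker ((comd (mulX I₃ 0) (mulX I₃ 1) (PP I₁ I₂ I₃ h21 h32)).comp
      (LinearMap.fst ℂ _ (Rxy ⧸ I₃))) := by
  ext ⟨⟨a, b⟩, v⟩
  rw [LinearMap.mem_ker, LinearMap.comp_apply, LinearMap.fst_apply, comd_apply]
  constructor
  · rintro ⟨D, hD⟩
    rw [EE_apply] at hD
    have e0 : devP I₁ I₂ I₃ h21 h32 0 D = a := congrArg (fun t => t.1.1) hD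
    have e1 : devP I₁ I₂ I₃ h21 h32 1 D = b := congrArg (fun t => t.1.2) hD
    rw [← e0, ← e1]
    refine LinearMap.ext fun w => ?_
    obtain ⟨r, rfl⟩ := qm_surj I₃ w
    simp only [LinearMap.add_apply, LinearMap.sub_apply, Module.End.mul_apply, mulX_apply,
      LinearMap.zero_apply]
    rw [← qm_mul, ← qm_mul, devP_qm, devP_qm, devP_qm, devP_qm]
    simp only [dev_apply, smul_sub]
    rw [mul_left_comm (X 1 : Rxy), smul_comm (X 0 : Rxy) (X 1 : Rxy)]
    abel
  · intro h
    obtain ⟨D, hv, ha, hb⟩ := exists_D I₃ a.1 b.1 v (fun w => DFunLike.congr_fun h w)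
    have hmem : ∀ {J : Ideal Rxy} (hJ : I₃ ≤ J),
        (∀ v ∈ Wof hJ, a.1 v ∈ Wof hJ) → (∀ v ∈ Wof hJ, b.1 v ∈ Wof hJ) → D ∈ DD hJ := by
      intro J hJ hAJ hBJ r hr i
      have hq := (qm_mem_Wof hJ r).2 hr
      fin_cases i
      · change dev I₃ 0 D r ∈ _
        rw [ha]; exact hAJ _ hq
      · change dev I₃ 1 D r ∈ _
        rw [hb]; exact hBJ _ hq
    have hW : ∀ v ∈ Wof (le_refl I₃), v = 0 := fun v hv => by
      rwa [mem_Wof, quotFactor_refl] at hv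
    refine ⟨⟨D, hmem _ a.2.1 b.2.1, hmem _ a.2.2 b.2.2, hmem _ ?_ ?_⟩, ?_⟩
    · intro v hv; rw [hW v hv]; simp
    · intro v hv; rw [hW v hv]; simp
    · rw [EE_apply]
      refine Prod.ext (Prod.ext ?_ ?_) hv
      · apply Subtype.ext
        refine LinearMap.ext fun w => ?_
        obtain ⟨r, rfl⟩ := qm_surj I₃ w
        rw [devP_qm, ha]
      · apply Subtype.ext
        refine LinearMap.ext fun w => ?_
        obtain ⟨r, rfl⟩ := qm_surj I₃ w
        rw [devP_qm, hb]

lemma rank_aux {P V W D T : Type*} [AddCommGroup P] [Module ℂ P] [AddCommGroup V] [Module ℂ V]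
    [AddCommGroup W] [Module ℂ W] [AddCommGroup D] [Module ℂ D] [AddCommGroup T] [Module ℂ T]
    [FiniteDimensional ℂ P] [FiniteDimensional ℂ V]
    (d : (P × P) →ₗ[ℂ] W) (E : D →ₗ[ℂ] ((P × P) × V)) (hE : Function.Injective E)
    (hr : LinearMap.range E = LinearMap.ker (d.comp (LinearMap.fst ℂ (P × P) V)))
    (F : D →ₗ[ℂ] T) (hF : Function.Surjective F) (G : P →ₗ[ℂ] D) (hG : Function.Injective G)
    (hGF : LinearMap.range G = LinearMap.ker F) :
    FiniteDimensional ℂ T ∧ Module.finrank ℂ T + Module.finrank ℂ (LinearMap.range d)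
      = Module.finrank ℂ P + Module.finrank ℂ V := by
  have : FiniteDimensional ℂ D := Module.Finite.of_injective _ hE
  have hT : FiniteDimensional ℂ T := Module.Finite.of_surjective _ hF
  refine ⟨hT, ?_⟩
  have r1 := LinearMap.finrank_range_add_finrank_ker F
  rw [LinearMap.range_eq_top.2 hF, finrank_top, ← hGF, LinearMap.finrank_range_of_inj hG] at r1
  have r2 := LinearMap.finrank_range_of_inj hE
  rw [hr] at r2
  have r3 := LinearMap.finrank_range_add_finrank_ker (d.comp (LinearMap.fst ℂ (P × P) V))
  rw [r2, LinearMap.range_comp_of_range_eq_top _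
    (LinearMap.range_eq_top.2 LinearMap.fst_surjective), Module.finrank_prod,
    Module.finrank_prod] at r3
  omega

lemma finrank_T [FiniteDimensional ℂ (Rxy ⧸ I₃)] :
    FiniteDimensional ℂ (flagTangent3 I₁ I₂ I₃ h21 h32) ∧
    Module.finrank ℂ (flagTangent3 I₁ I₂ I₃ h21 h32)
      + Module.finrank ℂ (nilp (Wof (h32.trans h21)) (Wof h32))
    = Module.finrank ℂ (Rxy ⧸ I₃) +
      Module.finrank ℂ (centr (mulX I₃ 0) (mulX I₃ 1) (nilp (Wof (h32.trans h21)) (Wof h32))) := by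
  have iP : FiniteDimensional ℂ (PP I₁ I₂ I₃ h21 h32) := inferInstance
  obtain ⟨hT, r1⟩ := rank_aux (P := PP I₁ I₂ I₃ h21 h32) (V := Rxy ⧸ I₃)
    (D := DDD I₁ I₂ I₃ h21 h32) (T := flagTangent3 I₁ I₂ I₃ h21 h32)
    (comd (mulX I₃ 0) (mulX I₃ 1) (PP I₁ I₂ I₃ h21 h32))
    (EE I₁ I₂ I₃ h21 h32) (EE_inj I₁ I₂ I₃ h21 h32) (range_EE I₁ I₂ I₃ h21 h32)
    (Phi I₁ I₂ I₃ h21 h32) (Phi_surj I₁ I₂ I₃ h21 h32)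
    (inclP I₁ I₂ I₃ h21 h32) (inclP_inj I₁ I₂ I₃ h21 h32) (range_inclP I₁ I₂ I₃ h21 h32)
  refine ⟨hT, ?_⟩
  have r4 := finrank_centr (mulX I₃ 0) (mulX I₃ 1) (Wof (h32.trans h21)) (Wof h32)
    (Wof_mono h32 h21)
  change _ + Module.finrank ℂ (LinearMap.range (comd _ _ (PP I₁ I₂ I₃ h21 h32)))
    = _ + Module.finrank ℂ (PP I₁ I₂ I₃ h21 h32) at r4
  omega

lemma rank_aux2 {U Z : Type*} [AddCommGroup U] [Module ℂ U] [AddCommGroup Z] [Module ℂ Z]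
    [FiniteDimensional ℂ U] (C N : Submodule ℂ U) (hNC : N ≤ C) (f : U →ₗ[ℂ] Z)
    (hs : ∀ z, ∃ c ∈ C, f c = z) (hk : ∀ c ∈ C, f c = 0 ↔ c ∈ N) :
    Module.finrank ℂ C = Module.finrank ℂ N + Module.finrank ℂ Z := by
  have r := LinearMap.finrank_range_add_finrank_ker (f.domRestrict C)
  have hs' : Function.Surjective (f.domRestrict C) := by
    intro z
    obtain ⟨c, hc, rfl⟩ := hs z
    exact ⟨⟨c, hc⟩, rfl⟩
  have hk' : LinearMap.ker (f.domRestrict C) = N.comap C.subtype := by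
    ext c
    exact hk c.1 c.2
  rw [LinearMap.range_eq_top.2 hs', finrank_top, hk',
    (Submodule.comapSubtypeEquivOfLe hNC).finrank_eq] at r
  omega

/-- The combinatorial data at the top of the flag. -/
structure FlagData (e₁ e₂ : Rxy ⧸ I₃) (ε₁ ε₂ : (Rxy ⧸ I₃) →ₗ[ℂ] ℂ) (s : Fin 2 → ℂ) : Prop where
  e11 : ε₁ e₁ = 1
  e12 : ε₁ e₂ = 0
  e21 : ε₂ e₁ = 0
  e22 : ε₂ e₂ = 1
  m1 : e₁ ∈ Wof (h32.trans h21)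
  m2 : e₂ ∈ Wof h32
  s1 : ∀ v ∈ Wof (h32.trans h21), v = ε₁ v • e₁ + ε₂ v • e₂
  s2 : ∀ v ∈ Wof h32, v = ε₂ v • e₂
  x1 : ∀ i, (X i : Rxy) • e₁ = s i • e₂
  x2 : ∀ i, (X i : Rxy) • e₂ = 0

lemma nilp_le_centr [FiniteDimensional ℂ (Rxy ⧸ I₃)] :
    nilp (Wof (h32.trans h21)) (Wof h32) ≤
    centr (mulX I₃ 0) (mulX I₃ 1) (nilp (Wof (h32.trans h21)) (Wof h32)) := by
  have key : ∀ i : Fin 2, ∀ C ∈ nilp (Wof (h32.trans h21)) (Wof h32),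
      C * mulX I₃ i - mulX I₃ i * C ∈ nilp (Wof (h32.trans h21)) (Wof h32) := by
    rintro i C ⟨h0, h1, h2⟩
    refine ⟨fun v => ?_, fun v hv => ?_, fun v hv => ?_⟩
    · exact Submodule.sub_mem _ (h0 _) (smul_mem_Wof _ _ (h0 _))
    · exact Submodule.sub_mem _ (h1 _ (smul_mem_Wof _ _ hv)) (smul_mem_Wof _ _ (h1 _ hv))
    · rw [LinearMap.sub_apply, Module.End.mul_apply, Module.End.mul_apply, h2 v hv,
        mulX_apply, h2 _ (smul_mem_Wof _ _ hv), map_zero, sub_zero]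
  intro C hC
  exact ⟨key 0 C hC, key 1 C hC⟩

lemma centr_comm [FiniteDimensional ℂ (Rxy ⧸ I₃)] (C : Module.End ℂ (Rxy ⧸ I₃))
    (hC : C ∈ centr (mulX I₃ 0) (mulX I₃ 1) (nilp (Wof (h32.trans h21)) (Wof h32)))
    (i : Fin 2) : C * mulX I₃ i - mulX I₃ i * C ∈ nilp (Wof (h32.trans h21)) (Wof h32) := by
  fin_cases i
  · exact hC.1
  · exact hC.2

lemma centr_W₁ [FiniteDimensional ℂ (Rxy ⧸ I₃)] (C : Module.End ℂ (Rxy ⧸ I₃))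
    (hC : C ∈ centr (mulX I₃ 0) (mulX I₃ 1) (nilp (Wof (h32.trans h21)) (Wof h32)))
    (h1 : C (qm I₃ 1) ∈ Wof (h32.trans h21)) (v : Rxy ⧸ I₃) : C v ∈ Wof (h32.trans h21) := by
  obtain ⟨p, rfl⟩ := qm_surj I₃ v
  induction p using MvPolynomial.induction_on with
  | C a =>
    rw [← mul_one (MvPolynomial.C a), ← MvPolynomial.smul_eq_C_mul, map_smul, map_smul]
    exact Submodule.smul_mem _ _ h1
  | add p q hp hq => rw [map_add, map_add]; exact Submodule.add_mem _ hp hq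
  | mul_X p i hp =>
    rw [mul_comm, qm_mul]
    have := Submodule.add_mem _ ((centr_comm I₁ I₂ I₃ h21 h32 C hC i).1 (qm I₃ p))
      (smul_mem_Wof (h32.trans h21) (X i) hp)
    rw [LinearMap.sub_apply, Module.End.mul_apply, Module.End.mul_apply, mulX_apply, mulX_apply,
      sub_add_cancel] at this
    exact this

/-- The test endomorphism. -/
def testC (e₁ e₂ : Rxy ⧸ I₃) (ε₁ ε₂ : (Rxy ⧸ I₃) →ₗ[ℂ] ℂ) (r : Rxy) (x y z : ℂ) :
    Module.End ℂ (Rxy ⧸ I₃) :=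
  Algebra.lsmul ℂ ℂ _ r + (ε₁.smulRight (x • e₁) + ε₂.smulRight (y • e₁ + z • e₂))

variable {I₁ I₂ I₃ h21 h32}

lemma testC_apply (e₁ e₂ : Rxy ⧸ I₃) (ε₁ ε₂ : (Rxy ⧸ I₃) →ₗ[ℂ] ℂ) (r : Rxy) (x y z : ℂ)
    (v : Rxy ⧸ I₃) : testC I₃ e₁ e₂ ε₁ ε₂ r x y z v =
      r • v + (ε₁ v • x • e₁ + ε₂ v • (y • e₁ + z • e₂)) := rfl

lemma csmul_comm (r : Rxy) (c : ℂ) (v : Rxy ⧸ I₃) : r • c • v = c • r • v := smul_comm r c v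

lemma testC_mem [FiniteDimensional ℂ (Rxy ⧸ I₃)] {e₁ e₂ : Rxy ⧸ I₃}
    {ε₁ ε₂ : (Rxy ⧸ I₃) →ₗ[ℂ] ℂ} {s : Fin 2 → ℂ}
    (H : FlagData I₁ I₂ I₃ h21 h32 e₁ e₂ ε₁ ε₂ s) (r : Rxy) (x y z : ℂ)
    (hy : ∀ i, y * s i = 0) :
    testC I₃ e₁ e₂ ε₁ ε₂ r x y z ∈
      centr (mulX I₃ 0) (mulX I₃ 1) (nilp (Wof (h32.trans h21)) (Wof h32)) := by
  have m1 := H.m1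
  have m2 := Wof_mono h32 h21 H.m2
  have key : ∀ i : Fin 2, testC I₃ e₁ e₂ ε₁ ε₂ r x y z * mulX I₃ i
      - mulX I₃ i * testC I₃ e₁ e₂ ε₁ ε₂ r x y z
        ∈ nilp (Wof (h32.trans h21)) (Wof h32) := by
    intro i
    have hform : ∀ v, (testC I₃ e₁ e₂ ε₁ ε₂ r x y z * mulX I₃ i
      - mulX I₃ i * testC I₃ e₁ e₂ ε₁ ε₂ r x y z) v =
        (ε₁ ((X i : Rxy) • v) • x • e₁ + ε₂ ((X i : Rxy) • v) • (y • e₁ + z • e₂))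
        - (ε₁ v * x * s i) • e₂ := by
      intro v
      have hz : y • s i • e₂ = 0 := by rw [smul_smul, hy, zero_smul]
      have hX : (X i : Rxy) • (ε₁ v • x • e₁ + ε₂ v • (y • e₁ + z • e₂))
          = (ε₁ v * x * s i) • e₂ := by
        rw [smul_add, csmul_comm, csmul_comm, csmul_comm, H.x1, smul_add (X i : Rxy), csmul_comm,
          csmul_comm, H.x1, H.x2, hz, smul_zero, add_zero, smul_zero, add_zero, smul_smul,
          smul_smul]
      rw [LinearMap.sub_apply, Module.End.mul_apply, Module.End.mul_apply, mulX_apply, mulX_apply,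
        testC_apply, testC_apply, smul_add (X i : Rxy), hX, smul_comm r (X i : Rxy)]
      abel
    refine ⟨fun v => ?_, fun v hv => ?_, fun v hv => ?_⟩
    · rw [hform]
      refine Submodule.sub_mem _ (Submodule.add_mem _ ?_ ?_) (Submodule.smul_mem _ _ m2)
      · exact Submodule.smul_mem _ _ (Submodule.smul_mem _ _ m1)
      · exact Submodule.smul_mem _ _ (Submodule.add_mem _ (Submodule.smul_mem _ _ m1)
          (Submodule.smul_mem _ _ m2))
    · rw [hform]
      have hX : (X i : Rxy) • v = (ε₁ v * s i) • e₂ := by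
        rw [H.s1 v hv, smul_add, csmul_comm, csmul_comm, H.x1, H.x2, smul_zero, add_zero,
          smul_smul]
        simp [H.e11, H.e12]
      rw [hX, map_smul, map_smul, H.e12, H.e22, smul_zero, zero_smul, zero_add, smul_eq_mul,
        mul_one, smul_add, smul_smul, mul_assoc, mul_comm (s i), hy, mul_zero, zero_smul, zero_add]
      exact Submodule.sub_mem _ (Submodule.smul_mem _ _ (Submodule.smul_mem _ _ H.m2))
        (Submodule.smul_mem _ _ H.m2)
    · rw [hform]
      have hX : (X i : Rxy) • v = 0 := by
        rw [H.s2 v hv, csmul_comm, H.x2, smul_zero]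
      have hε : ε₁ v = 0 := by
        rw [H.s2 v hv, map_smul, H.e12, smul_zero]
      rw [hX, hε]
      simp
  exact ⟨key 0, key 1⟩

lemma nilp_of_vals [FiniteDimensional ℂ (Rxy ⧸ I₃)] {e₁ e₂ : Rxy ⧸ I₃}
    {ε₁ ε₂ : (Rxy ⧸ I₃) →ₗ[ℂ] ℂ} {s : Fin 2 → ℂ}
    (H : FlagData I₁ I₂ I₃ h21 h32 e₁ e₂ ε₁ ε₂ s) (C : Module.End ℂ (Rxy ⧸ I₃))
    (h0 : ∀ v, C v ∈ Wof (h32.trans h21)) (h1 : ε₁ (C e₁) = 0) (h2 : ε₁ (C e₂) = 0)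
    (h3 : ε₂ (C e₂) = 0) : C ∈ nilp (Wof (h32.trans h21)) (Wof h32) := by
  have k2 : C e₂ = 0 := by rw [H.s1 _ (h0 e₂), h2, h3]; simp
  have k1 : C e₁ ∈ Wof h32 := by
    rw [H.s1 _ (h0 e₁), h1, zero_smul, zero_add]; exact Submodule.smul_mem _ _ H.m2
  refine ⟨h0, fun v hv => ?_, fun v hv => ?_⟩
  · rw [H.s1 v hv, map_add, map_smul, map_smul, k2, smul_zero, add_zero]
    exact Submodule.smul_mem _ _ k1
  · rw [H.s2 v hv, map_smul, k2, smul_zero]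

lemma vals_of_nilp [FiniteDimensional ℂ (Rxy ⧸ I₃)] {e₁ e₂ : Rxy ⧸ I₃}
    {ε₁ ε₂ : (Rxy ⧸ I₃) →ₗ[ℂ] ℂ} {s : Fin 2 → ℂ}
    (H : FlagData I₁ I₂ I₃ h21 h32 e₁ e₂ ε₁ ε₂ s) (C : Module.End ℂ (Rxy ⧸ I₃))
    (hC : C ∈ nilp (Wof (h32.trans h21)) (Wof h32)) :
    ε₁ (C e₁) = 0 ∧ C e₂ = 0 := by
  refine ⟨?_, hC.2.2 _ H.m2⟩
  rw [H.s2 _ (hC.2.1 _ H.m1), map_smul, H.e12, smul_zero]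

/-- The evaluation `C ↦ C(1)` modulo `I₁`. -/
def ev1 (h : I₃ ≤ I₁) : Module.End ℂ (Rxy ⧸ I₃) →ₗ[ℂ] (Rxy ⧸ I₁) :=
  ((quotFactor h).restrictScalars ℂ).comp (LinearMap.applyₗ (qm I₃ 1))

lemma ev1_apply (h : I₃ ≤ I₁) (C : Module.End ℂ (Rxy ⧸ I₃)) :
    ev1 h C = quotFactor h (C (qm I₃ 1)) := rfl

lemma ev1_testC {e₁ e₂ : Rxy ⧸ I₃}
    {ε₁ ε₂ : (Rxy ⧸ I₃) →ₗ[ℂ] ℂ} {s : Fin 2 → ℂ}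
    (H : FlagData I₁ I₂ I₃ h21 h32 e₁ e₂ ε₁ ε₂ s) (r : Rxy) (x y z : ℂ) :
    ev1 (h32.trans h21) (testC I₃ e₁ e₂ ε₁ ε₂ r x y z) = qm I₁ r := by
  rw [ev1_apply, testC_apply, map_add, ← qm_mul, mul_one, quotFactor_qm]
  have m1 := H.m1
  have m2 := Wof_mono h32 h21 H.m2
  have : (ε₁ (qm I₃ 1) • x • e₁ + ε₂ (qm I₃ 1) • (y • e₁ + z • e₂)) ∈ Wof (h32.trans h21) :=
    Submodule.add_mem _ (Submodule.smul_mem _ _ (Submodule.smul_mem _ _ m1))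
      (Submodule.smul_mem _ _ (Submodule.add_mem _ (Submodule.smul_mem _ _ m1)
          (Submodule.smul_mem _ _ m2)))
  rw [(mem_Wof _ _).1 this, add_zero]

/-- A matrix coefficient. -/
def coefE (ε : (Rxy ⧸ I₃) →ₗ[ℂ] ℂ) (e : Rxy ⧸ I₃) : Module.End ℂ (Rxy ⧸ I₃) →ₗ[ℂ] ℂ :=
  ε.comp (LinearMap.applyₗ e)

lemma coefE_apply (ε : (Rxy ⧸ I₃) →ₗ[ℂ] ℂ) (e : Rxy ⧸ I₃) (C : Module.End ℂ (Rxy ⧸ I₃)) :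
    coefE ε e C = ε (C e) := rfl

lemma finrank_split [FiniteDimensional ℂ (Rxy ⧸ I₃)] [FiniteDimensional ℂ (Rxy ⧸ I₁)]
    {e₁ e₂ : Rxy ⧸ I₃}
    {ε₁ ε₂ : (Rxy ⧸ I₃) →ₗ[ℂ] ℂ} {s : Fin 2 → ℂ}
    (H : FlagData I₁ I₂ I₃ h21 h32 e₁ e₂ ε₁ ε₂ s) (hs : ∀ i, s i = 0) :
    Module.finrank ℂ (centr (mulX I₃ 0) (mulX I₃ 1) (nilp (Wof (h32.trans h21)) (Wof h32)))
      = Module.finrank ℂ (nilp (Wof (h32.trans h21)) (Wof h32))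
        + (Module.finrank ℂ (Rxy ⧸ I₁) + 3) := by
  rw [rank_aux2 (centr (mulX I₃ 0) (mulX I₃ 1) (nilp (Wof (h32.trans h21)) (Wof h32)))
    (nilp (Wof (h32.trans h21)) (Wof h32)) (nilp_le_centr I₁ I₂ I₃ h21 h32)
    ((ev1 (h32.trans h21)).prod
      ((coefE ε₁ e₁).prod ((coefE ε₁ e₂).prod (coefE ε₂ e₂)))) ?_ ?_]
  · rw [Module.finrank_prod, Module.finrank_prod, Module.finrank_prod, Module.finrank_self]
  · rintro ⟨w, a, b, c⟩
    obtain ⟨r, rfl⟩ := qm_surj I₁ w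
    refine ⟨testC I₃ e₁ e₂ ε₁ ε₂ r (a - ε₁ (r • e₁)) (b - ε₁ (r • e₂)) (c - ε₂ (r • e₂)),
      testC_mem H _ _ _ _ (by simp [hs]), ?_⟩
    refine Prod.ext (ev1_testC H _ _ _ _) (Prod.ext ?_ (Prod.ext ?_ ?_))
    · change ε₁ (testC I₃ e₁ e₂ ε₁ ε₂ _ _ _ _ e₁) = a
      rw [testC_apply, H.e11, H.e21]
      simp [H.e11]
    · change ε₁ (testC I₃ e₁ e₂ ε₁ ε₂ _ _ _ _ e₂) = b
      rw [testC_apply, H.e12, H.e22]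
      simp [H.e11, H.e12]
    · change ε₂ (testC I₃ e₁ e₂ ε₁ ε₂ _ _ _ _ e₂) = c
      rw [testC_apply, H.e12, H.e22]
      simp [H.e21, H.e22]
  · intro C hC
    constructor
    · intro h
      have k0 : quotFactor (h32.trans h21) (C (qm I₃ 1)) = 0 := congrArg (fun t => t.1) h
      have k1 : ε₁ (C e₁) = 0 := congrArg (fun t => t.2.1) h
      have k2 : ε₁ (C e₂) = 0 := congrArg (fun t => t.2.2.1) h
      have k3 : ε₂ (C e₂) = 0 := congrArg (fun t => t.2.2.2) h
      exact nilp_of_vals H C (centr_W₁ I₁ I₂ I₃ h21 h32 C hC k0) k1 k2 k3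
    · intro h
      obtain ⟨k1, k2⟩ := vals_of_nilp H C h
      refine Prod.ext (h.1 _) (Prod.ext k1 (Prod.ext ?_ ?_))
      · change ε₁ (C e₂) = 0
        rw [k2, map_zero]
      · change ε₂ (C e₂) = 0
        rw [k2, map_zero]

lemma finrank_nonsplit [FiniteDimensional ℂ (Rxy ⧸ I₃)] [FiniteDimensional ℂ (Rxy ⧸ I₁)]
    {e₁ e₂ : Rxy ⧸ I₃}
    {ε₁ ε₂ : (Rxy ⧸ I₃) →ₗ[ℂ] ℂ} {s : Fin 2 → ℂ}
    (H : FlagData I₁ I₂ I₃ h21 h32 e₁ e₂ ε₁ ε₂ s) (i : Fin 2) (hs : s i = 1) :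
    Module.finrank ℂ (centr (mulX I₃ 0) (mulX I₃ 1) (nilp (Wof (h32.trans h21)) (Wof h32)))
      = Module.finrank ℂ (nilp (Wof (h32.trans h21)) (Wof h32))
        + (Module.finrank ℂ (Rxy ⧸ I₁) + 2) := by
  rw [rank_aux2 (centr (mulX I₃ 0) (mulX I₃ 1) (nilp (Wof (h32.trans h21)) (Wof h32)))
    (nilp (Wof (h32.trans h21)) (Wof h32)) (nilp_le_centr I₁ I₂ I₃ h21 h32)
    ((ev1 (h32.trans h21)).prod ((coefE ε₁ e₁).prod (coefE ε₂ e₂))) ?_ ?_]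
  · rw [Module.finrank_prod, Module.finrank_prod, Module.finrank_self]
  · rintro ⟨w, a, c⟩
    obtain ⟨r, rfl⟩ := qm_surj I₁ w
    refine ⟨testC I₃ e₁ e₂ ε₁ ε₂ r (a - ε₁ (r • e₁)) 0 (c - ε₂ (r • e₂)),
      testC_mem H _ _ _ _ (by simp), ?_⟩
    refine Prod.ext (ev1_testC H _ _ _ _) (Prod.ext ?_ ?_)
    · change ε₁ (testC I₃ e₁ e₂ ε₁ ε₂ _ _ _ _ e₁) = a
      rw [testC_apply, H.e11, H.e21]
      simp [H.e11]
    · change ε₂ (testC I₃ e₁ e₂ ε₁ ε₂ _ _ _ _ e₂) = c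
      rw [testC_apply, H.e12, H.e22]
      simp [H.e22]
  · intro C hC
    constructor
    · intro h
      have k0 : quotFactor (h32.trans h21) (C (qm I₃ 1)) = 0 := congrArg (fun t => t.1) h
      have k1 : ε₁ (C e₁) = 0 := congrArg (fun t => t.2.1) h
      have k3 : ε₂ (C e₂) = 0 := congrArg (fun t => t.2.2) h
      have hW := centr_W₁ I₁ I₂ I₃ h21 h32 C hC k0
      refine nilp_of_vals H C hW k1 ?_ k3
      have := (centr_comm I₁ I₂ I₃ h21 h32 C hC i).2.1 e₁ H.m1
      rw [LinearMap.sub_apply, Module.End.mul_apply, Module.End.mul_apply, mulX_apply, mulX_apply,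
        H.x1, hs, one_smul, H.s1 _ (hW e₁), k1, zero_smul, zero_add, csmul_comm, H.x2, smul_zero,
        sub_zero] at this
      rw [H.s2 _ this, map_smul, H.e12, smul_zero]
    · intro h
      obtain ⟨k1, k2⟩ := vals_of_nilp H C h
      refine Prod.ext (h.1 _) (Prod.ext k1 ?_)
      change ε₂ (C e₂) = 0
      rw [k2, map_zero]

end tangent

section young

/-- The exponent vector of a box. -/
def expo (c : ℕ × ℕ) : Fin 2 →₀ ℕ := Finsupp.single 0 c.1 + Finsupp.single 1 c.2

lemma expo_zero (c : ℕ × ℕ) : expo c 0 = c.1 := by simp [expo]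

lemma expo_one (c : ℕ × ℕ) : expo c 1 = c.2 := by simp [expo]

lemma expo_surj (s : Fin 2 →₀ ℕ) : expo (s 0, s 1) = s := by
  ext i
  fin_cases i
  · exact expo_zero _
  · exact expo_one _

lemma expo_inj {c d : ℕ × ℕ} (h : expo c = expo d) : c = d := by
  have h0 := DFunLike.congr_fun h 0
  have h1 := DFunLike.congr_fun h 1
  rw [expo_zero, expo_zero] at h0
  rw [expo_one, expo_one] at h1
  exact Prod.ext h0 h1

lemma mem_monomialIdeal (Γ : YoungDiagram) (f : Rxy) :
    f ∈ monomialIdeal Γ ↔ ∀ c ∈ Γ, coeff (expo c) f = 0 := by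
  have hset : {m : Rxy | ∃ u v : ℕ, (u, v) ∉ Γ ∧ m = X 0 ^ u * X 1 ^ v}
      = Set.image (fun s : Fin 2 →₀ ℕ => (monomial s (1 : ℂ) : Rxy)) {s | (s 0, s 1) ∉ Γ} := by
    ext m
    constructor
    · rintro ⟨u, v, huv, rfl⟩
      refine ⟨expo (u, v), ?_, ?_⟩
      · change (expo (u, v) 0, expo (u, v) 1) ∉ Γ
        rw [expo_zero, expo_one]; exact huv
      · change (monomial (expo (u, v)) (1 : ℂ) : Rxy) = _
        rw [monomial_eq_XX, expo_zero, expo_one]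
    · rintro ⟨s, hs, rfl⟩
      exact ⟨s 0, s 1, hs, monomial_eq_XX s⟩
  unfold monomialIdeal
  rw [hset, MvPolynomial.mem_ideal_span_monomial_image]
  constructor
  · intro H c hc
    by_contra hne
    obtain ⟨s, hs, hle⟩ := H (expo c) (MvPolynomial.mem_support_iff.2 hne)
    apply hs
    have h0 := hle 0
    have h1 := hle 1
    rw [expo_zero] at h0
    rw [expo_one] at h1
    exact Γ.up_left_mem h0 h1 hc
  · intro H s hs
    refine ⟨s, fun hmem => ?_, le_rfl⟩
    have := H _ hmem
    rw [expo_surj] at this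
    exact MvPolynomial.mem_support_iff.1 hs this

/-- Coefficients at the boxes. -/
def cmap (Γ : YoungDiagram) : Rxy →ₗ[ℂ] (Γ.cells → ℂ) :=
  LinearMap.pi fun c => MvPolynomial.lcoeff ℂ (expo c.1)

lemma cmap_apply (Γ : YoungDiagram) (f : Rxy) (c : Γ.cells) :
    cmap Γ f c = coeff (expo c.1) f := rfl

lemma ker_cmap (Γ : YoungDiagram) :
    LinearMap.ker (cmap Γ) = (monomialIdeal Γ).restrictScalars ℂ := by
  ext f
  rw [LinearMap.mem_ker, Submodule.restrictScalars_mem, mem_monomialIdeal]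
  constructor
  · intro h c hc
    exact congrFun h ⟨c, hc⟩
  · intro h
    funext c
    exact h c.1 c.2

lemma cmap_surj (Γ : YoungDiagram) : Function.Surjective (cmap Γ) := by
  intro g
  refine ⟨∑ c : Γ.cells, monomial (expo c.1) (g c), ?_⟩
  funext d
  rw [cmap_apply, MvPolynomial.coeff_sum, Finset.sum_eq_single d]
  · simp
  · intro c _ hcd
    rw [MvPolynomial.coeff_monomial, if_neg]
    intro h
    exact hcd (Subtype.ext (expo_inj h))
  · simp

/-- The coordinate isomorphism. -/
def kap (Γ : YoungDiagram) : (Rxy ⧸ monomialIdeal Γ) ≃ₗ[ℂ] (Γ.cells → ℂ) :=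
  (Submodule.Quotient.restrictScalarsEquiv ℂ (monomialIdeal Γ)).symm.trans
    ((Submodule.quotEquivOfEq _ _ (ker_cmap Γ).symm).trans
      ((cmap Γ).quotKerEquivOfSurjective (cmap_surj Γ)))

lemma kap_qm (Γ : YoungDiagram) (f : Rxy) (c : Γ.cells) :
    kap Γ (qm (monomialIdeal Γ) f) c = coeff (expo c.1) f := rfl

lemma fin_quot (Γ : YoungDiagram) : FiniteDimensional ℂ (Rxy ⧸ monomialIdeal Γ) :=
  Module.Finite.equiv (kap Γ).symm

lemma finrank_quot (Γ : YoungDiagram) :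
    Module.finrank ℂ (Rxy ⧸ monomialIdeal Γ) = Γ.card := by
  rw [(kap Γ).finrank_eq, Module.finrank_fintype_fun_eq_card, Fintype.card_coe]

/-- The coordinate functional at a box. -/
def epsf (Γ : YoungDiagram) (c : Γ.cells) : (Rxy ⧸ monomialIdeal Γ) →ₗ[ℂ] ℂ :=
  (LinearMap.proj c).comp (kap Γ).toLinearMap

lemma epsf_qm (Γ : YoungDiagram) (f : Rxy) (c : Γ.cells) :
    epsf Γ c (qm (monomialIdeal Γ) f) = coeff (expo c.1) f := rfl

/-- The monomial of a box. -/
abbrev mono (c : ℕ × ℕ) : Rxy := monomial (expo c) 1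

lemma coeff_mono (c d : ℕ × ℕ) : coeff (expo d) (mono c) = if c = d then 1 else 0 := by
  rw [MvPolynomial.coeff_monomial]
  by_cases h : c = d
  · simp [h]
  · rw [if_neg h, if_neg (fun h' => h (expo_inj h'))]

/-- Shift of a box. -/
def shiftB (i : Fin 2) (c : ℕ × ℕ) : ℕ × ℕ := if i = 0 then (c.1 + 1, c.2) else (c.1, c.2 + 1)

lemma X_mul_mono (i : Fin 2) (c : ℕ × ℕ) : (X i * mono c : Rxy) = mono (shiftB i c) := by
  rw [mono, X, monomial_mul, one_mul]
  have key : Finsupp.single i 1 + expo c = expo (shiftB i c) := by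
    refine Finsupp.ext fun j => ?_
    fin_cases i <;> fin_cases j <;> simp [expo, shiftB, add_comm]
  rw [key]

lemma mono_mem (Γ : YoungDiagram) (c : ℕ × ℕ) : mono c ∈ monomialIdeal Γ ↔ c ∉ Γ := by
  rw [mem_monomialIdeal]
  constructor
  · intro h hc
    have := h c hc
    rw [coeff_mono, if_pos rfl] at this
    exact one_ne_zero this
  · intro hc d hd
    rw [coeff_mono, if_neg]
    rintro rfl
    exact hc hd

lemma shiftB_notMem (Γ Γ' : YoungDiagram) (b : ℕ × ℕ) (hb : b ∉ Γ)
    (h : Γ'.cells = insert b Γ.cells) (i : Fin 2) : shiftB i b ∉ Γ' := by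
  intro hm
  rw [← YoungDiagram.mem_cells, h, Finset.mem_insert] at hm
  have hne : shiftB i b ≠ b := by
    intro he
    have h1 := congrArg Prod.fst he
    have h2 := congrArg Prod.snd he
    fin_cases i <;> simp [shiftB] at h1 h2
  rcases hm with hm | hm
  · exact hne hm
  · apply hb
    rw [YoungDiagram.mem_cells] at hm
    have : shiftB i b = ((shiftB i b).1, (shiftB i b).2) := rfl
    rw [this] at hm
    refine Γ.up_left_mem ?_ ?_ hm
    · unfold shiftB; split_ifs <;> simp
    · unfold shiftB; split_ifs <;> simp

open Classical in
lemma flagData_young (Γ₁ Γ₂ Γ₃ : YoungDiagram) (b₁ b₂ : ℕ × ℕ)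
    (hb₁ : b₁ ∉ Γ₁) (hΓ₂ : Γ₂.cells = insert b₁ Γ₁.cells)
    (hb₂ : b₂ ∉ Γ₂) (hΓ₃ : Γ₃.cells = insert b₂ Γ₂.cells)
    (h21 : monomialIdeal Γ₂ ≤ monomialIdeal Γ₁)
    (h32 : monomialIdeal Γ₃ ≤ monomialIdeal Γ₂)
    (m1 : b₁ ∈ Γ₃.cells) (m2 : b₂ ∈ Γ₃.cells) :
    FlagData (monomialIdeal Γ₁) (monomialIdeal Γ₂) (monomialIdeal Γ₃) h21 h32
      (qm _ (mono b₁)) (qm _ (mono b₂)) (epsf Γ₃ ⟨b₁, m1⟩) (epsf Γ₃ ⟨b₂, m2⟩)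
      (fun i => if b₂ = shiftB i b₁ then 1 else 0) := by
  have mem2 : ∀ c, c ∈ Γ₂ ↔ c = b₁ ∨ c ∈ Γ₁ := fun c => by
    rw [← YoungDiagram.mem_cells, hΓ₂, Finset.mem_insert, YoungDiagram.mem_cells]
  have mem3 : ∀ c, c ∈ Γ₃ ↔ c = b₂ ∨ c ∈ Γ₂ := fun c => by
    rw [← YoungDiagram.mem_cells, hΓ₃, Finset.mem_insert, YoungDiagram.mem_cells]
  have hne : b₁ ≠ b₂ := by
    rintro rfl
    exact hb₂ ((mem2 _).2 (Or.inl rfl))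
  have hb21 : b₂ ∉ Γ₁ := fun h => hb₂ ((mem2 _).2 (Or.inr h))
  refine ⟨?_, ?_, ?_, ?_, ?_, ?_, ?_, ?_, ?_, ?_⟩
  · rw [epsf_qm, coeff_mono, if_pos rfl]
  · rw [epsf_qm, coeff_mono, if_neg hne.symm]
  · rw [epsf_qm, coeff_mono, if_neg hne]
  · rw [epsf_qm, coeff_mono, if_pos rfl]
  · rw [qm_mem_Wof, mono_mem]; exact hb₁
  · rw [qm_mem_Wof, mono_mem]; exact hb₂
  · intro v hv
    obtain ⟨f, rfl⟩ := qm_surj _ v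
    rw [qm_mem_Wof, mem_monomialIdeal] at hv
    rw [epsf_qm, epsf_qm, ← map_smul (qm (monomialIdeal Γ₃)) _ (mono b₁),
      ← map_smul (qm (monomialIdeal Γ₃)) _ (mono b₂), ← map_add, ← sub_eq_zero, ← map_sub, qm_eq_zero,
      mem_monomialIdeal]
    intro c hc
    rw [coeff_sub, coeff_add, coeff_smul, coeff_smul, coeff_mono, coeff_mono]
    rcases (mem3 c).1 hc with rfl | hc
    · simp [hne]
    rcases (mem2 c).1 hc with rfl | hc
    · simp [hne.symm]
    · rw [hv c hc, if_neg, if_neg]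
      · simp
      · rintro rfl; exact hb21 hc
      · rintro rfl; exact hb₁ hc
  · intro v hv
    obtain ⟨f, rfl⟩ := qm_surj _ v
    rw [qm_mem_Wof, mem_monomialIdeal] at hv
    rw [epsf_qm, ← map_smul (qm (monomialIdeal Γ₃)) _ (mono b₂), ← sub_eq_zero, ← map_sub, qm_eq_zero, mem_monomialIdeal]
    intro c hc
    rw [coeff_sub, coeff_smul, coeff_mono]
    rcases (mem3 c).1 hc with rfl | hc
    · simp
    · rw [hv c hc, if_neg]
      · simp
      · rintro rfl; exact hb₂ hc
  · intro i
    rw [← qm_mul, X_mul_mono]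
    by_cases h : b₂ = shiftB i b₁
    · simp only [if_pos h, one_smul]
      rw [h]
    · simp only [if_neg h, zero_smul]
      rw [qm_eq_zero, mono_mem, mem3]
      rintro (h' | h')
      · exact h h'.symm
      · exact shiftB_notMem Γ₁ Γ₂ b₁ hb₁ hΓ₂ i h'
  · intro i
    rw [← qm_mul, X_mul_mono, qm_eq_zero, mono_mem]
    exact shiftB_notMem Γ₂ Γ₃ b₂ hb₂ hΓ₃ i

end young

/-- Dimension of the tangent space to `Hilb^{n,n+1,n+2}(ℂ²)` at a monomial flag:
`2n+4` in case b) (the two added boxes are adjacent, the second directly to the right of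
or directly above the first), and `2n+5` in case a) (otherwise). -/
theorem statement2 (n : ℕ) (Γ₁ Γ₂ Γ₃ : YoungDiagram) (b₁ b₂ : ℕ × ℕ)
    (hcard : Γ₁.card = n)
    (hb₁ : b₁ ∉ Γ₁) (hΓ₂ : Γ₂.cells = insert b₁ Γ₁.cells)
    (hb₂ : b₂ ∉ Γ₂) (hΓ₃ : Γ₃.cells = insert b₂ Γ₂.cells)
    (h21 : monomialIdeal Γ₂ ≤ monomialIdeal Γ₁)
    (h32 : monomialIdeal Γ₃ ≤ monomialIdeal Γ₂) :
    Module.rank ℂ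
        ↥(flagTangent3 (monomialIdeal Γ₁) (monomialIdeal Γ₂) (monomialIdeal Γ₃) h21 h32)
      = if b₂ = (b₁.1 + 1, b₁.2) ∨ b₂ = (b₁.1, b₁.2 + 1)
          then ((2 * n + 4 : ℕ) : Cardinal)
          else ((2 * n + 5 : ℕ) : Cardinal) := by
  classical
  have m1 : b₁ ∈ Γ₃.cells := by rw [hΓ₃, hΓ₂]; simp
  have m2 : b₂ ∈ Γ₃.cells := by rw [hΓ₃]; simp
  have H := flagData_young Γ₁ Γ₂ Γ₃ b₁ b₂ hb₁ hΓ₂ hb₂ hΓ₃ h21 h32 m1 m2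
  have f1 := fin_quot Γ₁
  have f3 := fin_quot Γ₃
  have n3 : Γ₃.card = n + 2 := by
    have hb₁' : b₁ ∉ Γ₁.cells := hb₁
    have hb₂' : b₂ ∉ Γ₂.cells := hb₂
    change Γ₃.cells.card = n + 2
    rw [hΓ₃, Finset.card_insert_of_notMem hb₂', hΓ₂, Finset.card_insert_of_notMem hb₁']
    change Γ₁.card + 1 + 1 = n + 2
    omega
  obtain ⟨fT, hT⟩ := finrank_T (monomialIdeal Γ₁) (monomialIdeal Γ₂) (monomialIdeal Γ₃) h21 h32
  rw [finrank_quot, n3] at hT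
  rw [← Module.finrank_eq_rank]
  split_ifs with hc
  · have hi : ∃ i : Fin 2, b₂ = shiftB i b₁ := by
      rcases hc with hc | hc
      · exact ⟨0, hc⟩
      · exact ⟨1, hc⟩
    obtain ⟨i, hi⟩ := hi
    have hN := finrank_nonsplit H i (if_pos hi)
    rw [finrank_quot, hcard] at hN
    congr 1
    omega
  · have hN := finrank_split H (fun i => if_neg (fun hi => hc (by
      fin_cases i
      · exact Or.inl hi
      · exact Or.inr hi)))
    rw [finrank_quot, hcard] at hN
    congr 1
    omega
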